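/- arXiv:1001.1093 — 2 statements merged into one kernel-verified Lean document; each statement's English description precedes it below -/
import Mathlib

section
/- (Receivers of a Cart8 site are confined to at most two IPEs) Let t : Fin 8 → D assign frequencies to eight transmission paths with |t(i) − t(j)| ≥ 100 for all i ≠ j, and let r : Fin 8 → D assign frequencies to eight reception paths with |t(i) − r(j)| ≥ 220 for all i, j. Then no IPE contains both a transmission frequency t(i) and a reception frequency r(j), and the set of IPEs containing at least one reception frequency r(0), …, r(7) has cardinality at most 2. -/
/-- The first small IPE. -/
def IPE0 : Finset ℕ := {40000, 40070, 40140}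
/-- The second small IPE. -/
def IPE1 : Finset ℕ := {41000, 41070, 41140}
/-- The third small IPE. -/
def IPE2 : Finset ℕ := {42000, 42070, 42140}
/-- The fourth small IPE. -/
def IPE3 : Finset ℕ := {43000, 43070, 43140}
/-- The first large IPE. -/
def IPE4 : Finset ℕ := {44000, 44070, 44140, 44210}
/-- The second large IPE. -/
def IPE5 : Finset ℕ := {45000, 45070, 45140, 45210}

/-- The list of the four small IPEs. -/
def smallIPEs : List (Finset ℕ) := [IPE0, IPE1, IPE2, IPE3]
/-- The list of the two large IPEs. -/
def largeIPEs : List (Finset ℕ) := [IPE4, IPE5]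
/-- The list of all six IPEs. -/
def allIPEs : List (Finset ℕ) := [IPE0, IPE1, IPE2, IPE3, IPE4, IPE5]
/-- The six IPEs as a finite set of finite sets. -/
def IPEs : Finset (Finset ℕ) := {IPE0, IPE1, IPE2, IPE3, IPE4, IPE5}
/-- The frequency domain: the union of the six IPEs. -/
def Dom : Finset ℕ := IPE0 ∪ IPE1 ∪ IPE2 ∪ IPE3 ∪ IPE4 ∪ IPE5

/-- Every IPE lies in an arithmetic progression of length four and step 70. -/
theorem exists_progression_of_mem_IPEs {I : Finset ℕ} (hI : I ∈ IPEs) :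
    ∃ a, ∀ x ∈ I, ∃ k ≤ 3, x = a + 70 * k := by
  simp only [IPEs, Finset.mem_insert, Finset.mem_singleton] at hI
  rcases hI with rfl | rfl | rfl | rfl | rfl | rfl
  · exact ⟨40000, by decide⟩
  · exact ⟨41000, by decide⟩
  · exact ⟨42000, by decide⟩
  · exact ⟨43000, by decide⟩
  · exact ⟨44000, by decide⟩
  · exact ⟨45000, by decide⟩

theorem exists_IPE_of_mem_Dom {x : ℕ} (hx : x ∈ Dom) : ∃ I ∈ IPEs, x ∈ I := by
  simp only [Dom, Finset.mem_union] at hx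
  simp only [IPEs, Finset.mem_insert, Finset.mem_singleton, exists_eq_or_imp, exists_eq_left]
  tauto

/-- Two frequencies of the same IPE are less than 220 apart. -/
theorem abs_sub_lt_of_mem_IPE {I : Finset ℕ} (hI : I ∈ IPEs) {x y : ℕ} (hx : x ∈ I)
    (hy : y ∈ I) : |(x : ℤ) - (y : ℤ)| < 220 := by
  obtain ⟨a, ha⟩ := exists_progression_of_mem_IPEs hI
  obtain ⟨k, hk, rfl⟩ := ha x hx
  obtain ⟨l, hl, rfl⟩ := ha y hy
  rw [abs_lt]
  omega

/-- An IPE contains at most two of any family of frequencies with pairwise gaps at least 100. -/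
theorem card_filter_mem_IPE_le_two {ι : Type*} [Fintype ι] {t : ι → ℕ}
    (htt : ∀ i j, i ≠ j → |(t i : ℤ) - (t j : ℤ)| ≥ 100) {I : Finset ℕ} (hI : I ∈ IPEs) :
    (Finset.univ.filter (fun i => t i ∈ I)).card ≤ 2 := by
  by_contra! h
  obtain ⟨i, j, k, hi, hj, hk, hij, hik, hjk⟩ := Finset.two_lt_card_iff.mp h
  simp only [Finset.mem_filter, Finset.mem_univ, true_and] at hi hj hk
  obtain ⟨a, ha⟩ := exists_progression_of_mem_IPEs hI
  obtain ⟨p, hp, hpi⟩ := ha _ hi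
  obtain ⟨q, hq, hqj⟩ := ha _ hj
  obtain ⟨s, hs, hsk⟩ := ha _ hk
  have h₁ := le_abs.mp (htt i j hij)
  have h₂ := le_abs.mp (htt i k hik)
  have h₃ := le_abs.mp (htt j k hjk)
  omega

/-- for a Cart8 site, no IPE contains both a transmission frequency
and a reception frequency, and the reception frequencies are confined to at
most two IPEs. -/
theorem cart8_receivers_confined_to_two_IPEs
    (t r : Fin 8 → ℕ)
    (ht : ∀ i, t i ∈ Dom) (hr : ∀ j, r j ∈ Dom)
    (htt : ∀ i j, i ≠ j → |(t i : ℤ) - (t j : ℤ)| ≥ 100)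
    (htr : ∀ i j, |(t i : ℤ) - (r j : ℤ)| ≥ 220) :
    (∀ I ∈ IPEs, ¬ ((∃ i, t i ∈ I) ∧ (∃ j, r j ∈ I))) ∧
    (IPEs.filter (fun I => ∃ j, r j ∈ I)).card ≤ 2 := by
  have hdisj : ∀ I ∈ IPEs, ¬ ((∃ i, t i ∈ I) ∧ (∃ j, r j ∈ I)) := by
    rintro I hI ⟨⟨i, hi⟩, j, hj⟩
    exact (abs_sub_lt_of_mem_IPE hI hi hj).not_ge (htr i j)
  refine ⟨hdisj, ?_⟩
  choose c hc htc using fun i => exists_IPE_of_mem_Dom (ht i)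
  have hcount : Fintype.card (Fin 8) ≤ 2 * (IPEs.filter (fun I => ∃ i, t i ∈ I)).card := by
    refine Finset.card_le_mul_card_image_of_maps_to (f := c)
      (fun i _ => Finset.mem_filter.mpr ⟨hc i, i, htc i⟩) 2 fun I hI => ?_
    refine (Finset.card_le_card fun i hi => ?_).trans
      (card_filter_mem_IPE_le_two htt (Finset.mem_filter.mp hI).1)
    simp only [Finset.mem_filter, Finset.mem_univ, true_and] at hi ⊢
    exact hi ▸ htc i
  have hsum : (IPEs.filter (fun I => ∃ i, t i ∈ I)).card
      + (IPEs.filter (fun I => ∃ j, r j ∈ I)).card ≤ IPEs.card := by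
    rw [← Finset.card_union_of_disjoint
      (Finset.disjoint_filter.mpr fun I hI hT hR => hdisj I hI ⟨hT, hR⟩)]
    exact Finset.card_le_card
      (Finset.union_subset (Finset.filter_subset _ _) (Finset.filter_subset _ _))
  have hcard : IPEs.card ≤ 6 := Finset.card_le_six
  rw [Fintype.card_fin] at hcount
  omega
end

section
/- (Maximum number of pairwise-separated transmitters in D) Any subset S ⊆ D such that all distinct f, g ∈ S satisfy |f − g| ≥ 100 has cardinality at most 12, and this bound is attained: the set consisting of the two extreme frequencies of each of the six IPEs, {40000, 40140, 41000, 41140, 42000, 42140, 43000, 43140, 44000, 44210, 45000, 45210}, has 12 elements with all pairwise differences at least 100. -/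
/-- The half of an IPE to which a frequency belongs: each IPE is split into its frequencies
less than 100 above its least element and the remaining ones. -/
def halfIndex (f : ℕ) : ℕ := 2 * (f / 1000) + min 1 (f % 1000 / 100)

theorem halfIndex_mem_Ico : ∀ f ∈ Dom, halfIndex f ∈ Finset.Ico 80 92 := by
  simp [Dom, IPE0, IPE1, IPE2, IPE3, IPE4, IPE5, halfIndex]

theorem lt_add_of_halfIndex_eq {f g : ℕ} (hf : f ∈ Dom) (hg : g ∈ Dom)
    (h : halfIndex f = halfIndex g) : f < g + 100 := by
  simp only [Dom, IPE0, IPE1, IPE2, IPE3, IPE4, IPE5, Finset.mem_union, Finset.mem_insert,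
    Finset.mem_singleton] at hf hg
  unfold halfIndex at h
  omega

/-- any subset of the domain whose elements are pairwise separated
by at least 100 has at most 12 elements, and the bound is attained by the set
of the two extreme frequencies of each of the six IPEs. -/
theorem max_pairwise_separated_transmitters :
    (∀ S : Finset ℕ, S ⊆ Dom →
      (∀ f ∈ S, ∀ g ∈ S, f ≠ g → |(f : ℤ) - (g : ℤ)| ≥ 100) →
      S.card ≤ 12) ∧
    (({40000, 40140, 41000, 41140, 42000, 42140, 43000, 43140,
       44000, 44210, 45000, 45210} : Finset ℕ) ⊆ Dom ∧
     ({40000, 40140, 41000, 41140, 42000, 42140, 43000, 43140,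
       44000, 44210, 45000, 45210} : Finset ℕ).card = 12 ∧
     (∀ f ∈ ({40000, 40140, 41000, 41140, 42000, 42140, 43000, 43140,
              44000, 44210, 45000, 45210} : Finset ℕ),
      ∀ g ∈ ({40000, 40140, 41000, 41140, 42000, 42140, 43000, 43140,
              44000, 44210, 45000, 45210} : Finset ℕ),
        f ≠ g → |(f : ℤ) - (g : ℤ)| ≥ 100)) := by
  refine ⟨fun S hS hsep => ?_, ?_, ?_, ?_⟩
  · refine Finset.card_le_card_of_injOn (t := Finset.Ico 80 92) halfIndex
      (fun f hf => halfIndex_mem_Ico f (hS hf)) fun f hf g hg h => ?_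
    by_contra hne
    have hfg := lt_add_of_halfIndex_eq (hS hf) (hS hg) h
    have hgf := lt_add_of_halfIndex_eq (hS hg) (hS hf) h.symm
    have hgap := le_abs.mp (hsep f hf g hg hne)
    omega
  · decide
  · rfl
  · decide
end
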